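/- For every (k_1,…,k_n) ∈ [1,r]^n, one has b_{[k_1,…,k_n]} = ( ∏_{1 ≤ i < j ≤ n with k_i = k_j} e_{i,j} ) · ( ∏_{1 ≤ i < j ≤ n with k_i ≠ k_j} (1 − e_{i,j}) ) in H_{n,r}, where b_{[k_1,…,k_n]} := Σ_{(ℓ_1,…,ℓ_n) ∈ [1,r]^n such that (ℓ_i = ℓ_j ⟺ k_i = k_j for all i,j)} b_{ℓ_1,…,ℓ_n} is the sum of the b's over the S_r-orbit of (k_1,…,k_n). -/

import Mathlib

open Polynomial

namespace MAK

noncomputable section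

variable (R : Type*) [CommRing R] (n r : ℕ) (q Δ : Rˣ) (u : Fin r → R) (F : Fin r → R[X])

/-- The free `R`-algebra on generators `t_1, …, t_n` (left) and `T_1, …, T_{n-1}` (right). -/
abbrev FA := FreeAlgebra R (Fin n ⊕ Fin (n - 1))

/-- The generators `t_i`. -/
def tf (i : Fin n) : FA R n := FreeAlgebra.ι R (Sum.inl i)

/-- The generators `T_j`. -/
def Tf (j : Fin (n - 1)) : FA R n := FreeAlgebra.ι R (Sum.inr j)

/-- The index `j`, viewed in `Fin n`. -/
def lo (j : Fin (n - 1)) : Fin n := ⟨j.1, by have := j.2; omega⟩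

/-- The index `j + 1`, viewed in `Fin n`. -/
def hi (j : Fin (n - 1)) : Fin n := ⟨j.1 + 1, by have := j.2; omega⟩

/-- The element `B_j = Δ⁻² Σ_{c1<c2} (u_{c2} - u_{c1})(q - q⁻¹) F_{c1}(t_j) F_{c2}(t_{j+1})`. -/
def Bel (j : Fin (n - 1)) : FA R n :=
  ∑ c2 : Fin r, ∑ c1 ∈ Finset.univ.filter (fun c1 => c1 < c2),
    (((Δ⁻¹ : Rˣ) : R) ^ 2 * ((u c2 - u c1) * ((q : R) - ((q⁻¹ : Rˣ) : R)))) •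
      (aeval (tf R n (lo n j)) (F c1) * aeval (tf R n (hi n j)) (F c2))

/-- The defining relations of the modified Ariki-Koike algebra. -/
inductive Rel : FA R n → FA R n → Prop
  | quad (j : Fin (n - 1)) :
      Rel ((Tf R n j - algebraMap R (FA R n) (q : R)) *
        (Tf R n j + algebraMap R (FA R n) ((q⁻¹ : Rˣ) : R))) 0
  | tord (i : Fin n) : Rel (aeval (tf R n i) (∏ c : Fin r, (X - C (u c)))) 0
  | braid (j k : Fin (n - 1)) (h : k.1 = j.1 + 1) :
      Rel (Tf R n j * Tf R n k * Tf R n j) (Tf R n k * Tf R n j * Tf R n k)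
  | Tcomm (j k : Fin (n - 1)) (h : j.1 + 2 ≤ k.1 ∨ k.1 + 2 ≤ j.1) :
      Rel (Tf R n j * Tf R n k) (Tf R n k * Tf R n j)
  | tcomm (i i' : Fin n) : Rel (tf R n i * tf R n i') (tf R n i' * tf R n i)
  | Tt (j : Fin (n - 1)) (i : Fin n) (h1 : i ≠ lo n j) (h2 : i ≠ hi n j) :
      Rel (Tf R n j * tf R n i) (tf R n i * Tf R n j)
  | Thi (j : Fin (n - 1)) :
      Rel (Tf R n j * tf R n (hi n j)) (tf R n (lo n j) * Tf R n j + Bel R n r q Δ u F j)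
  | Tlo (j : Fin (n - 1)) :
      Rel (Tf R n j * tf R n (lo n j)) (tf R n (hi n j) * Tf R n j - Bel R n r q Δ u F j)

/-- The modified Ariki-Koike algebra `H_{n,r}(R, q, u_1, …, u_r)`. -/
abbrev Hnr := RingQuot (Rel R n r q Δ u F)

/-- The canonical projection. -/
def pim : FA R n →ₐ[R] Hnr R n r q Δ u F := RingQuot.mkAlgHom R (Rel R n r q Δ u F)

/-- The generator `t_i` of `H_{n,r}`. -/
def tt (i : Fin n) : Hnr R n r q Δ u F := pim R n r q Δ u F (tf R n i)

/-- The generator `T_j` of `H_{n,r}`. -/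
def TT (j : Fin (n - 1)) : Hnr R n r q Δ u F := pim R n r q Δ u F (Tf R n j)

/-- The Lagrange basis polynomial `∏_{j ≠ c} (X - u_j)/(u_c - u_j)`. -/
def bpoly (c : Fin r) : R[X] :=
  ∏ j ∈ Finset.univ.filter (fun j => j ≠ c), Ring.inverse (u c - u j) • (X - C (u j))

/-- The idempotent `b_{k_1, …, k_n}`. -/
def b (k : Fin n → Fin r) : Hnr R n r q Δ u F :=
  (List.ofFn fun i : Fin n => aeval (tt R n r q Δ u F i) (bpoly R r u (k i))).prod

/-- The element `B'_{i,j} = -(q - q⁻¹) Σ_{k_i < k_j} b_{k_1, …, k_n}`. -/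
def B' (i j : Fin n) : Hnr R n r q Δ u F :=
  -(((q : R) - ((q⁻¹ : Rˣ) : R)) •
    ∑ k ∈ Finset.univ.filter (fun k : Fin n → Fin r => k i < k j), b R n r q Δ u F k)

/-- The element `g_i := T_i + B'_{i,i+1}`. -/
def g (j : Fin (n - 1)) : Hnr R n r q Δ u F :=
  TT R n r q Δ u F j + B' R n r q Δ u F (lo n j) (hi n j)

/-- The idempotent `e_{i,j} = Σ_{k_i = k_j} b_{k_1, …, k_n}`. -/
def eij (i j : Fin n) : Hnr R n r q Δ u F :=
  ∑ k ∈ Finset.univ.filter (fun k : Fin n → Fin r => k i = k j), b R n r q Δ u F k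

/-- The idempotent `e_i = e_{i,i+1}`. -/
def ee (j : Fin (n - 1)) : Hnr R n r q Δ u F := eij R n r q Δ u F (lo n j) (hi n j)

/-- The simple transposition `s_j = (j, j+1)` in `S_n`. -/
def simple (j : Fin (n - 1)) : Equiv.Perm (Fin n) := Equiv.swap (lo n j) (hi n j)

/-- `l` is a reduced word for the permutation `w`. -/
def IsReducedWord (w : Equiv.Perm (Fin n)) (l : List (Fin (n - 1))) : Prop :=
  (l.map (simple n)).prod = w ∧
    ∀ l' : List (Fin (n - 1)), (l'.map (simple n)).prod = w → l.length ≤ l'.length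

/-- The element `g_w = g_{i_1} ⋯ g_{i_l}` associated to a word `l = (i_1, …, i_l)`. -/
def gword (l : List (Fin (n - 1))) : Hnr R n r q Δ u F := (l.map (g R n r q Δ u F)).prod

/-- The element `T_w = T_{i_1} ⋯ T_{i_l}` associated to a word `l = (i_1, …, i_l)`. -/
def Tword (l : List (Fin (n - 1))) : Hnr R n r q Δ u F := (l.map (TT R n r q Δ u F)).prod

/-- The monomial `t_1^{c_1} ⋯ t_n^{c_n}`. -/
def tmon (c : Fin n → ℕ) : Hnr R n r q Δ u F :=
  (List.ofFn fun i : Fin n => tt R n r q Δ u F i ^ c i).prod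

end

end MAK

open MAK


namespace MAK

section Idempotents

variable {ι κ A : Type*} [Fintype ι] [DecidableEq ι]

/-- The ring homomorphism `f ↦ ∑ k, f k • e k` from integer-valued functions attached to a
complete family of orthogonal idempotents. -/
def piIdempotentsHom [Ring A] {e : ι → A} (he : CompleteOrthogonalIdempotents e) :
    (ι → ℤ) →+* A where
  toFun f := ∑ k, f k • e k
  map_one' := by simpa using he.complete
  map_zero' := by simp
  map_add' f g := by simp [add_smul, Finset.sum_add_distrib]
  map_mul' f g := by
    simp only [Finset.sum_mul_sum, Pi.mul_apply, smul_mul_smul_comm, he.mul_eq, smul_ite,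
      smul_zero, Finset.sum_ite_eq, Finset.mem_univ, if_true]

theorem piIdempotentsHom_indicator [Ring A] {e : ι → A} (he : CompleteOrthogonalIdempotents e)
    (p : ι → Prop) [DecidablePred p] :
    piIdempotentsHom he (fun k => if p k then 1 else 0) =
      ∑ k ∈ Finset.univ.filter p, e k := by
  simp [piIdempotentsHom, Finset.sum_filter]

theorem completeOrthogonalIdempotents_prod [CommRing A] [Fintype κ] [DecidableEq κ]
    {x : ι → κ → A} (hx : ∀ i, CompleteOrthogonalIdempotents (x i)) :
    CompleteOrthogonalIdempotents fun k : ι → κ => ∏ i, x i (k i) where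
  idem k := by
    rw [IsIdempotentElem, ← Finset.prod_mul_distrib]
    exact Finset.prod_congr rfl fun i _ => (hx i).idem (k i)
  ortho k l hkl := by
    obtain ⟨i, hi⟩ := Function.ne_iff.mp hkl
    rw [← Finset.prod_mul_distrib]
    exact Finset.prod_eq_zero (Finset.mem_univ i) ((hx i).ortho hi)
  complete := by
    rw [← Fintype.prod_sum]
    simp [(hx _).complete]

end Idempotents

theorem isUnit_sub_of_isUnit_prod {R : Type*} [CommRing R] {r : ℕ} {u : Fin r → R}
    (h : IsUnit (∏ i : Fin r, ∏ j ∈ Finset.univ.filter (fun j => j < i), (u i - u j)))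
    {c d : Fin r} (hcd : c ≠ d) : IsUnit (u c - u d) := by
  have key : ∀ {c d : Fin r}, d < c → IsUnit (u c - u d) := by
    intro c d hdc
    refine isUnit_of_dvd_unit (dvd_trans ?_ (Finset.dvd_prod_of_mem _ (Finset.mem_univ c))) h
    exact Finset.dvd_prod_of_mem (fun j => u c - u j) (by simpa using hdc)
  rcases lt_or_gt_of_ne hcd with h | h
  · rw [← neg_sub]
    exact (key h).neg
  · exact key h

section Lagrange

variable {R : Type*} [CommRing R] {r : ℕ} {u : Fin r → R}

theorem eval_bpoly (hu : ∀ c d : Fin r, c ≠ d → IsUnit (u c - u d)) (c d : Fin r) :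
    (bpoly R r u c).eval (u d) = if c = d then 1 else 0 := by
  rw [bpoly, eval_prod]
  split_ifs with h
  · subst h
    refine Finset.prod_eq_one fun j hj => ?_
    simp only [eval_smul, eval_sub, eval_X, eval_C, smul_eq_mul]
    exact Ring.inverse_mul_cancel _ (hu c j (Ne.symm (by simpa using hj)))
  · exact Finset.prod_eq_zero (i := d) (by simpa using Ne.symm h) (by simp)

theorem degree_bpoly_lt [Nontrivial R] (c : Fin r) : (bpoly R r u c).degree < r := by
  refine (degree_prod_le _ _).trans_lt ?_
  refine (Finset.sum_le_sum (g := fun _ => (1 : WithBot ℕ)) fun j _ =>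
    (degree_smul_le _ _).trans (degree_X_sub_C_le _)).trans_lt ?_
  have : (Finset.univ.filter fun j : Fin r => j ≠ c).card < r := by
    simpa using Finset.card_lt_card (s := Finset.univ.filter fun j : Fin r => j ≠ c)
      (t := Finset.univ) (by simp [Finset.filter_ssubset])
  simpa using this

theorem sum_bpoly [IsDomain R] (hr : 1 ≤ r) (hu : ∀ c d : Fin r, c ≠ d → IsUnit (u c - u d)) :
    ∑ c, bpoly R r u c = 1 := by
  have hinj : Set.InjOn u (Finset.univ : Finset (Fin r)) := by
    intro c _ d _ h
    by_contra hcd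
    exact (hu c d hcd).ne_zero (sub_eq_zero.mpr h)
  refine Polynomial.eq_of_degrees_lt_of_eval_index_eq Finset.univ hinj ?_ ?_ ?_
  · rw [Finset.card_univ, Fintype.card_fin]
    refine (degree_sum_le _ _).trans_lt ?_
    exact (Finset.sup_lt_iff (WithBot.bot_lt_coe r)).mpr fun c _ => degree_bpoly_lt c
  · rw [degree_one, Finset.card_univ, Fintype.card_fin]
    exact_mod_cast hr
  · intro d _
    simp [eval_finsetSum, eval_bpoly hu]

theorem prod_X_sub_C_dvd_bpoly_mul_bpoly (hu : ∀ c d : Fin r, c ≠ d → IsUnit (u c - u d))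
    {c d : Fin r} (hcd : c ≠ d) :
    (∏ a : Fin r, (X - C (u a))) ∣ bpoly R r u c * bpoly R r u d := by
  refine Finset.prod_dvd_of_coprime (fun a _ a' _ h => ?_) fun a _ => ?_
  · exact isCoprime_X_sub_C_of_isUnit_sub (hu a a' h)
  · rw [dvd_iff_isRoot, IsRoot, eval_mul, eval_bpoly hu, eval_bpoly hu]
    by_cases h : c = a
    · simp [← h, hcd.symm]
    · simp [h]

theorem completeOrthogonalIdempotents_aeval_bpoly [IsDomain R] (hr : 1 ≤ r)
    (hu : ∀ c d : Fin r, c ≠ d → IsUnit (u c - u d)) {A : Type*} [Ring A] [Algebra R A] {a : A}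
    (ha : aeval a (∏ c : Fin r, (X - C (u c))) = 0) :
    CompleteOrthogonalIdempotents fun c => aeval a (bpoly R r u c) := by
  have hortho : Pairwise fun c d => aeval a (bpoly R r u c) * aeval a (bpoly R r u d) = 0 := by
    intro c d hcd
    obtain ⟨p, hp⟩ := prod_X_sub_C_dvd_bpoly_mul_bpoly hu hcd
    rw [← map_mul, hp, map_mul, ha, zero_mul]
  have hsum : ∑ c, aeval a (bpoly R r u c) = 1 := by
    rw [← map_sum, sum_bpoly hr hu, map_one]
  exact CompleteOrthogonalIdempotents.iff_ortho_complete.mpr ⟨hortho, hsum⟩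

end Lagrange

section Algebra

variable {R : Type*} [CommRing R] {n r : ℕ} {q Δ : Rˣ} {u : Fin r → R} {F : Fin r → R[X]}

theorem tt_mul_comm (i j : Fin n) :
    tt R n r q Δ u F i * tt R n r q Δ u F j = tt R n r q Δ u F j * tt R n r q Δ u F i := by
  simp only [tt, ← map_mul]
  exact RingQuot.mkAlgHom_rel R (Rel.tcomm i j)

theorem aeval_tt_prod_X_sub_C (i : Fin n) :
    aeval (tt R n r q Δ u F i) (∏ c : Fin r, (X - C (u c))) = 0 := by
  rw [tt, aeval_algHom_apply]
  exact (RingQuot.mkAlgHom_rel R (Rel.tord i)).trans (map_zero _)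

theorem completeOrthogonalIdempotents_b [IsDomain R] (hr : 1 ≤ r)
    (hu : ∀ c d : Fin r, c ≠ d → IsUnit (u c - u d)) :
    CompleteOrthogonalIdempotents (b R n r q Δ u F) := by
  let S := Algebra.adjoin R (Set.range (tt R n r q Δ u F))
  have hS : IsMulCommutative S := Algebra.isMulCommutative_adjoin R <| by
    rintro _ ⟨i, rfl⟩ _ ⟨j, rfl⟩
    exact tt_mul_comm i j
  let : CommRing S := { mul_comm := hS.is_comm.comm }
  let s : Fin n → S := fun i => ⟨tt R n r q Δ u F i, Algebra.subset_adjoin ⟨i, rfl⟩⟩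
  have hval : ∀ i p, S.val (aeval (s i) p) = aeval (tt R n r q Δ u F i) p := fun i p =>
    (aeval_algHom_apply S.val (s i) p).symm
  have hs : ∀ i, CompleteOrthogonalIdempotents fun c => aeval (s i) (bpoly R r u c) := by
    intro i
    refine completeOrthogonalIdempotents_aeval_bpoly hr hu (Subtype.val_injective ?_)
    exact (hval i _).trans (aeval_tt_prod_X_sub_C i)
  have hb := (completeOrthogonalIdempotents_prod hs).map S.val.toRingHom
  convert hb using 1
  funext k
  change _ = S.val (∏ i, aeval (s i) (bpoly R r u (k i)))
  rw [b, ← List.prod_ofFn, map_list_prod, List.map_ofFn]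
  simp only [Function.comp_def, hval]

end Algebra

theorem prod_indicator_eq_indicator {n : ℕ} {α : Type*} [DecidableEq α] (k l : Fin n → α) :
    (∏ i, ∏ j, if i < j ∧ k i = k j then if l i = l j then (1 : ℤ) else 0 else 1) *
      (∏ i, ∏ j, if i < j ∧ k i ≠ k j then 1 - (if l i = l j then (1 : ℤ) else 0) else 1) =
      if ∀ i j, l i = l j ↔ k i = k j then 1 else 0 := by
  split_ifs with h
  · rw [Finset.prod_eq_one fun i _ => Finset.prod_eq_one fun j _ => ?_,
      Finset.prod_eq_one fun i _ => Finset.prod_eq_one fun j _ => ?_, one_mul]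
    · grind
    · grind
  · have : ∃ i j, i < j ∧ ¬(l i = l j ↔ k i = k j) := by
      push Not at h
      obtain ⟨i, j, hij⟩ := h
      rcases lt_trichotomy i j with h | h | h
      · exact ⟨i, j, h, by grind⟩
      · grind
      · exact ⟨j, i, h, by grind⟩
    obtain ⟨i, j, hij, hne⟩ := this
    by_cases hk : k i = k j
    · refine mul_eq_zero_of_left ?_ _
      refine Finset.prod_eq_zero (Finset.mem_univ i) (Finset.prod_eq_zero (Finset.mem_univ j) ?_)
      grind
    · refine mul_eq_zero_of_right _ ?_
      refine Finset.prod_eq_zero (Finset.mem_univ i) (Finset.prod_eq_zero (Finset.mem_univ j) ?_)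
      grind

end MAK

/-- Lemma 5.4: `b_{[k_1,…,k_n]} = (∏_{i<j, k_i=k_j} e_{i,j}) (∏_{i<j, k_i≠k_j} (1-e_{i,j}))`. -/
theorem statement19
    (R : Type*) [CommRing R] [IsDomain R] (n r : ℕ) (hn : 1 ≤ n) (hr : 1 ≤ r)
    (q Δ : Rˣ) (u : Fin r → R) (F : Fin r → R[X])
    (hΔ : (Δ : R) = ∏ i : Fin r, ∏ j ∈ Finset.univ.filter (fun j => j < i), (u i - u j))
    (hFdeg : ∀ c : Fin r, (F c).degree = ((r - 1 : ℕ) : WithBot ℕ))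
    (hFeval : ∀ c c' : Fin r, (F c).eval (u c') = if c' = c then (Δ : R) else 0)
    (k : Fin n → Fin r) :
    (∑ l ∈ Finset.univ.filter
        (fun l : Fin n → Fin r => ∀ i j : Fin n, l i = l j ↔ k i = k j),
      b R n r q Δ u F l) =
    ((List.finRange n).map fun i =>
        ((List.finRange n).map fun j =>
          if i < j ∧ k i = k j then eij R n r q Δ u F i j else 1).prod).prod *
    ((List.finRange n).map fun i =>
        ((List.finRange n).map fun j =>
          if i < j ∧ k i ≠ k j then 1 - eij R n r q Δ u F i j else 1).prod).prod := by
  have he := completeOrthogonalIdempotents_b (n := n) (q := q) (Δ := Δ) (F := F) hr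
    fun c d => isUnit_sub_of_isUnit_prod (hΔ ▸ Δ.isUnit)
  have heij : ∀ i j, eij R n r q Δ u F i j =
      piIdempotentsHom he fun l => if l i = l j then 1 else 0 := fun i j =>
    (piIdempotentsHom_indicator he fun l => l i = l j).symm
  rw [← piIdempotentsHom_indicator he]
  have hone_sub : ∀ i j, 1 - eij R n r q Δ u F i j =
      piIdempotentsHom he fun l => 1 - if l i = l j then 1 else 0 := fun i j => by
    rw [heij, ← map_one (piIdempotentsHom he), ← map_sub]
    rfl
  have hite : ∀ (p : Prop) [Decidable p] (f : (Fin n → Fin r) → ℤ),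
      (if p then piIdempotentsHom he f else 1) =
        piIdempotentsHom he fun l => if p then f l else 1 := fun p _ f => by
    split_ifs
    · rfl
    · exact (map_one (piIdempotentsHom he)).symm
  have hprod : ∀ f : Fin n → Fin n → (Fin n → Fin r) → ℤ,
      ((List.finRange n).map fun i =>
        ((List.finRange n).map fun j => piIdempotentsHom he (f i j)).prod).prod =
      piIdempotentsHom he (∏ i, ∏ j, f i j) := fun f => by
    simp only [Fin.prod_univ_def, map_list_prod, List.map_map, Function.comp_def]
  simp only [hone_sub]
  simp only [heij, hite, hprod, ← map_mul]
  congr 1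
  funext l
  simpa [Finset.prod_apply] using (prod_indicator_eq_indicator k l).symm
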